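/- arXiv:0809.4794 — 3 statements merged into one kernel-verified Lean document; each statement's English description precedes it below -/
import Mathlib

section
/- Let λ > 0 and let a, b be real numbers. Then for every measurable set S ⊆ ℝ, Lap(a, λ)(S) ≤ exp(|a − b|/λ) · Lap(b, λ)(S). In particular, if |a − b| ≤ Δ then exp(−Δ/λ)·Lap(b, λ)(S) ≤ Lap(a, λ)(S) ≤ exp(Δ/λ)·Lap(b, λ)(S) for every measurable S. -/
open MeasureTheory

/-- The Laplace measure `Lap(μ, lam)`: the measure on `ℝ` with density
`y ↦ (1/(2·lam)) · exp (-|y - μ| / lam)` with respect to Lebesgue measure. -/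
noncomputable def lapMeasure (μ lam : ℝ) : Measure ℝ :=
  volume.withDensity fun y => ENNReal.ofReal ((1 / (2 * lam)) * Real.exp (-|y - μ| / lam))

/-- The Laplace measure with parameter `a` is dominated by `exp (Δ / lam)` times the one with
parameter `b` whenever `|a - b| ≤ Δ`. -/
theorem lapMeasure_apply_le {lam a b Δ : ℝ} (hlam : 0 < lam) (h : |a - b| ≤ Δ) {S : Set ℝ}
    (hS : MeasurableSet S) :
    lapMeasure a lam S ≤ ENNReal.ofReal (Real.exp (Δ / lam)) * lapMeasure b lam S := by
  unfold lapMeasure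
  rw [withDensity_apply _ hS, withDensity_apply _ hS, ← lintegral_const_mul _ (by fun_prop)]
  refine lintegral_mono fun y => ?_
  rw [← ENNReal.ofReal_mul (Real.exp_pos _).le, mul_left_comm, ← Real.exp_add, ← add_div]
  have hy : |y - b| ≤ |y - a| + |a - b| := abs_sub_le y a b
  gcongr
  linarith

/-- For every measurable `S`, `Lap(a, lam)(S) ≤ exp(|a - b|/lam) · Lap(b, lam)(S)`;
in particular, if `|a - b| ≤ Δ` then
`exp(-Δ/lam) · Lap(b, lam)(S) ≤ Lap(a, lam)(S) ≤ exp(Δ/lam) · Lap(b, lam)(S)`. -/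
theorem laplace_measure_ratio_bound (lam a b : ℝ) (hlam : 0 < lam) :
    (∀ S : Set ℝ, MeasurableSet S →
      lapMeasure a lam S ≤ ENNReal.ofReal (Real.exp (|a - b| / lam)) * lapMeasure b lam S) ∧
    (∀ Δ : ℝ, |a - b| ≤ Δ → ∀ S : Set ℝ, MeasurableSet S →
      ENNReal.ofReal (Real.exp (-Δ / lam)) * lapMeasure b lam S ≤ lapMeasure a lam S ∧
      lapMeasure a lam S ≤ ENNReal.ofReal (Real.exp (Δ / lam)) * lapMeasure b lam S) := by
  refine ⟨fun S hS => lapMeasure_apply_le hlam le_rfl hS,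
    fun Δ h S hS => ⟨?_, lapMeasure_apply_le hlam h hS⟩⟩
  calc ENNReal.ofReal (Real.exp (-Δ / lam)) * lapMeasure b lam S
      ≤ ENNReal.ofReal (Real.exp (-Δ / lam)) *
          (ENNReal.ofReal (Real.exp (Δ / lam)) * lapMeasure a lam S) := by
        gcongr
        exact lapMeasure_apply_le hlam (abs_sub_comm a b ▸ h) hS
    _ = lapMeasure a lam S := by
        rw [← mul_assoc, ← ENNReal.ofReal_mul (Real.exp_pos _).le, ← Real.exp_add, ← add_div]
        simp
end

section
/- Let D be a type, let k and t be positive integers with n = k·t, let Λ > 0 and ε > 0, and let g : (Fin t → D) → ℝ be any function taking values in the interval [0, Λ]. For a database x : Fin k → Fin t → D (viewed as k disjoint blocks of t entries each), define the block average z̄(x) = (1/k)·Σ_{j=1}^{k} g(x_j), and let μ_x = Lap(z̄(x), Λ/(k·ε)) be the distribution of the output of the sample-and-aggregate mechanism on input x. Then for every pair of neighboring databases x, x' (agreeing in all entries except at most one entry of one block) and every measurable set S ⊆ ℝ, μ_x(S) ≤ exp(ε) · μ_{x'}(S). In other words, the sample-and-aggregate mechanism with Laplace noise of scale Λ/(k·ε)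 is ε-differentially private. -/
open MeasureTheory

/-- Two databases `x, x' : Fin k → Fin t → D` (k blocks of t entries each) are
neighbors if they agree in all entries except at most one entry of one block. -/
def Neighbors {D : Type*} {k t : ℕ} (x x' : Fin k → Fin t → D) : Prop :=
  ∃ j₀ : Fin k, ∃ i₀ : Fin t, ∀ j : Fin k, ∀ i : Fin t, (j, i) ≠ (j₀, i₀) → x j i = x' j i

theorem lapMeasure_le_smul {μ ν lam ε : ℝ} (hlam : 0 < lam) (h : |μ - ν| ≤ lam * ε) :
    lapMeasure μ lam ≤ ENNReal.ofReal (Real.exp ε) • lapMeasure ν lam := by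
  unfold lapMeasure
  rw [← withDensity_smul _ (by fun_prop)]
  refine withDensity_mono (Filter.Eventually.of_forall fun y => ?_)
  simp only [Pi.smul_apply, smul_eq_mul]
  rw [← ENNReal.ofReal_mul (Real.exp_pos ε).le]
  refine ENNReal.ofReal_le_ofReal ?_
  rw [mul_left_comm, ← Real.exp_add]
  gcongr
  rw [div_le_iff₀ hlam, add_mul, div_mul_cancel₀ _ hlam.ne']
  have := abs_sub_le y μ ν
  linarith

/-- Changing a single block moves the block average of a `[0, Λ]`-valued function by at most
`Λ / k`. -/
theorem Neighbors.abs_average_sub_le {D : Type*} {k t : ℕ} {Λ : ℝ} {g : (Fin t → D) → ℝ}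
    (hg : ∀ v, g v ∈ Set.Icc 0 Λ) {x x' : Fin k → Fin t → D} (h : Neighbors x x') :
    |(1 / (k : ℝ)) * ∑ j, g (x j) - (1 / (k : ℝ)) * ∑ j, g (x' j)| ≤ Λ / k := by
  obtain ⟨j₀, i₀, hx⟩ := h
  have hsum : ∑ j, g (x j) - ∑ j, g (x' j) = g (x j₀) - g (x' j₀) := by
    rw [← Finset.sum_sub_distrib]
    refine Finset.sum_eq_single_of_mem j₀ (Finset.mem_univ _) fun j _ hj => ?_
    rw [funext fun i => hx j i fun e => hj (congrArg Prod.fst e), sub_self]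
  rw [← mul_sub, hsum, abs_mul, abs_of_nonneg (by positivity), one_div_mul_eq_div]
  gcongr
  rw [abs_le]
  constructor <;> linarith [(hg (x j₀)).1, (hg (x j₀)).2, (hg (x' j₀)).1, (hg (x' j₀)).2]

/-- The sample-and-aggregate mechanism, which on input `x` releases the block average
`z̄(x) = (1/k)·Σ_j g(x_j)` perturbed by Laplace noise of scale `Λ/(k·ε)`, is
`ε`-differentially private: for neighboring databases `x, x'` and every measurable `S`,
`μ_x(S) ≤ exp(ε) · μ_{x'}(S)` where `μ_x = Lap(z̄(x), Λ/(k·ε))`. -/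
theorem sample_and_aggregate_private {D : Type*} (k t : ℕ) (hk : 0 < k) (ht : 0 < t)
    (Λ ε : ℝ) (hΛ : 0 < Λ) (hε : 0 < ε)
    (g : (Fin t → D) → ℝ) (hg : ∀ v, g v ∈ Set.Icc 0 Λ)
    (x x' : Fin k → Fin t → D) (hnb : Neighbors x x')
    (S : Set ℝ) (hS : MeasurableSet S) :
    lapMeasure ((1 / (k : ℝ)) * ∑ j, g (x j)) (Λ / (k * ε)) S ≤
      ENNReal.ofReal (Real.exp ε) *
        lapMeasure ((1 / (k : ℝ)) * ∑ j, g (x' j)) (Λ / (k * ε)) S := by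
  have hk' : (0 : ℝ) < k := by exact_mod_cast hk
  refine lapMeasure_le_smul (by positivity) ?_ S
  refine (hnb.abs_average_sub_le hg).trans_eq ?_
  field_simp
end

section
/- Let Λ > 0, V ≥ 0, C ≥ 0, and let (ε_n)_{n≥1} be positive reals with n^{1/6}·ε_n → ∞; set k_n = ⌈n^{3/5}·Λ^{2/5}·ε_n^{−2/5}⌉. Suppose (v_n)_{n≥1} and (b_n)_{n≥1} are sequences of reals with v_n ≥ 0, (n/k_n)·v_n → V as n → ∞, and |b_n| ≤ C·(k_n/n)^{3/2} for all n. Then n·( v_n/k_n + b_n² + 2Λ²/(k_n²·ε_n²) ) → V as n → ∞. In particular, if v_n is the variance of each block estimate, b_n its bias, and 2Λ²/(k_n²·ε_n²) the variance of the added Laplace noise, then the rescaled mean squared error n·J_n of the sample-and-aggregate estimator converges to the same limit V as the rescaled variance of a single block estimate divided by the number of blocks. -/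
open Filter

/-- Rewriting the real number of blocks in terms of `n^{1/6}·e`. -/
lemma blocks_eq_rpow {n e L : ℝ} (hn : 0 < n) (he : 0 < e) :
    n ^ ((3 : ℝ) / 5) * L * e ^ (-(2 : ℝ) / 5) =
      n ^ ((2 : ℝ) / 3) * (L * (n ^ ((1 : ℝ) / 6) * e) ^ (-((2 : ℝ) / 5))) := by
  rw [Real.mul_rpow (by positivity) he.le, ← Real.rpow_mul hn.le,
    show (3 : ℝ) / 5 = 2 / 3 + 1 / 6 * (-(2 / 5)) by norm_num, Real.rpow_add hn,
    show (-(2 : ℝ) / 5) = -(2 / 5) by norm_num]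
  ring

/-- The product of the squared real number of blocks and the squared privacy budget. -/
lemma sq_blocks_mul_sq_eq {n e L : ℝ} (hn : 0 < n) (he : 0 < e) :
    (n ^ ((3 : ℝ) / 5) * L * e ^ (-(2 : ℝ) / 5)) ^ 2 * e ^ 2 =
      n * (L ^ 2 * (n ^ ((1 : ℝ) / 6) * e) ^ ((6 : ℝ) / 5)) := by
  rw [Real.mul_rpow (by positivity) he.le, ← Real.rpow_mul hn.le, mul_pow, mul_pow,
    ← Real.rpow_mul_natCast hn.le, ← Real.rpow_mul_natCast he.le]
  have h1 : n ^ ((3 : ℝ) / 5 * (2 : ℕ)) = n * n ^ ((1 : ℝ) / 6 * (6 / 5)) := by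
    rw [← Real.rpow_one_add' hn.le (by norm_num)]
    norm_num
  have h2 : e ^ (-(2 : ℝ) / 5 * (2 : ℕ)) * e ^ 2 = e ^ ((6 : ℝ) / 5) := by
    rw [← Real.rpow_natCast e 2, ← Real.rpow_add he]
    norm_num
  rw [h1, mul_assoc, h2]
  ring

/-- The number of blocks is `o(n^{2/3})`, in cubed form. -/
lemma tendsto_blocks_pow_three_div_sq {L : ℝ} (hL : 0 ≤ L) {ε : ℕ → ℝ} (hε : ∀ n, 0 < ε n)
    (hlim : Tendsto (fun n : ℕ => (n : ℝ) ^ ((1 : ℝ) / 6) * ε n) atTop atTop)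
    {k : ℕ → ℕ}
    (hk : ∀ n, k n = ⌈(n : ℝ) ^ ((3 : ℝ) / 5) * L * ε n ^ (-(2 : ℝ) / 5)⌉₊) :
    Tendsto (fun n : ℕ => (k n : ℝ) ^ 3 / (n : ℝ) ^ 2) atTop (nhds 0) := by
  have hu := (tendsto_rpow_neg_atTop (show (0 : ℝ) < 2 / 5 by norm_num)).comp hlim
  have hn := (tendsto_rpow_neg_atTop (show (0 : ℝ) < 2 / 3 by norm_num)).comp
    (tendsto_natCast_atTop_atTop (R := ℝ))
  have hbound := ((hu.const_mul L).add hn).pow 3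
  norm_num at hbound
  refine squeeze_zero' (Eventually.of_forall fun n => by positivity) ?_ hbound
  filter_upwards [eventually_gt_atTop 0] with n hn0
  have hn0 : (0 : ℝ) < n := by exact_mod_cast hn0
  have he := hε n
  have hle : (k n : ℝ) ≤ (n : ℝ) ^ ((3 : ℝ) / 5) * L * ε n ^ (-(2 : ℝ) / 5) + 1 := by
    rw [hk]
    exact (Nat.ceil_lt_add_one (by positivity)).le
  rw [blocks_eq_rpow hn0 he] at hle
  have hsq : (n : ℝ) ^ 2 = ((n : ℝ) ^ ((2 : ℝ) / 3)) ^ 3 := by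
    rw [← Real.rpow_mul_natCast hn0.le, ← Real.rpow_natCast]
    norm_num
  rw [hsq, ← div_pow]
  refine pow_le_pow_left₀ (by positivity) ?_ 3
  rw [div_le_iff₀ (by positivity)]
  refine hle.trans (le_of_eq ?_)
  have hinv : (n : ℝ) ^ (-((2 : ℝ) / 3)) * (n : ℝ) ^ ((2 : ℝ) / 3) = 1 := by
    rw [← Real.rpow_add hn0]
    norm_num
  simp only [one_div] at hinv ⊢
  rw [add_mul, hinv]
  ring

/-- The rescaled variance of the Laplace noise vanishes. -/
lemma tendsto_mul_laplace_variance {L : ℝ} (hL : 0 < L) (c : ℝ) {ε : ℕ → ℝ}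
    (hε : ∀ n, 0 < ε n)
    (hlim : Tendsto (fun n : ℕ => (n : ℝ) ^ ((1 : ℝ) / 6) * ε n) atTop atTop)
    {k : ℕ → ℕ}
    (hk : ∀ n, k n = ⌈(n : ℝ) ^ ((3 : ℝ) / 5) * L * ε n ^ (-(2 : ℝ) / 5)⌉₊) :
    Tendsto (fun n : ℕ => (n : ℝ) * (c / ((k n : ℝ) ^ 2 * ε n ^ 2))) atTop (nhds 0) := by
  have hu := ((tendsto_rpow_neg_atTop (show (0 : ℝ) < 6 / 5 by norm_num)).comp
    hlim).const_mul ((L ^ 2)⁻¹)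
  rw [mul_zero] at hu
  have hmain : Tendsto (fun n : ℕ => (n : ℝ) / ((k n : ℝ) ^ 2 * ε n ^ 2)) atTop (nhds 0) := by
    refine squeeze_zero' (Eventually.of_forall fun n => by positivity) ?_ hu
    filter_upwards [eventually_gt_atTop 0] with n hn0
    have hn0 : (0 : ℝ) < n := by exact_mod_cast hn0
    have he := hε n
    have hle : (n : ℝ) ^ ((3 : ℝ) / 5) * L * ε n ^ (-(2 : ℝ) / 5) ≤ k n := by
      rw [hk]
      exact Nat.le_ceil _
    calc (n : ℝ) / ((k n : ℝ) ^ 2 * ε n ^ 2)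
        ≤ n / (((n : ℝ) ^ ((3 : ℝ) / 5) * L * ε n ^ (-(2 : ℝ) / 5)) ^ 2 * ε n ^ 2) := by
          gcongr
      _ = (L ^ 2)⁻¹ * ((n : ℝ) ^ ((1 : ℝ) / 6) * ε n) ^ (-((6 : ℝ) / 5)) := by
          rw [sq_blocks_mul_sq_eq hn0 he, Real.rpow_neg (by positivity)]
          field_simp
  have h := hmain.const_mul c
  rw [mul_zero] at h
  exact h.congr fun n => by ring

/-- A bias of order `(k_n/n)^{3/2}` is negligible after rescaling when `k_n³ = o(n²)`. -/
lemma tendsto_mul_sq_bias {C : ℝ} {k : ℕ → ℕ} {b : ℕ → ℝ}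
    (hk : Tendsto (fun n : ℕ => (k n : ℝ) ^ 3 / (n : ℝ) ^ 2) atTop (nhds 0))
    (hb : ∀ n, |b n| ≤ C * ((k n : ℝ) / (n : ℝ)) ^ ((3 : ℝ) / 2)) :
    Tendsto (fun n : ℕ => (n : ℝ) * b n ^ 2) atTop (nhds 0) := by
  have h := hk.const_mul (C ^ 2)
  rw [mul_zero] at h
  refine squeeze_zero' (Eventually.of_forall fun n => by positivity) ?_ h
  filter_upwards [eventually_gt_atTop 0] with n hn0
  have hn0 : (0 : ℝ) < n := by exact_mod_cast hn0
  have hsq : (((k n : ℝ) / n) ^ ((3 : ℝ) / 2)) ^ 2 = ((k n : ℝ) / n) ^ 3 := by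
    rw [← Real.rpow_mul_natCast (by positivity), ← Real.rpow_natCast _ 3]
    norm_num
  calc (n : ℝ) * b n ^ 2 = n * |b n| ^ 2 := by rw [sq_abs]
    _ ≤ n * (C * ((k n : ℝ) / n) ^ ((3 : ℝ) / 2)) ^ 2 := by
        gcongr
        exact hb n
    _ = C ^ 2 * ((k n : ℝ) ^ 3 / (n : ℝ) ^ 2) := by
        rw [mul_pow, hsq]
        field_simp

/-- With `k_n = ⌈n^{3/5}·Λ^{2/5}·ε_n^{−2/5}⌉`, `n^{1/6}·ε_n → ∞`, block-estimate
variances `v_n ≥ 0` with `(n/k_n)·v_n → V`, and biases `|b_n| ≤ C·(k_n/n)^{3/2}`,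
the rescaled mean squared error
`n·(v_n/k_n + b_n² + 2Λ²/(k_n²·ε_n²))` of the sample-and-aggregate estimator
converges to `V`. -/
theorem sample_and_aggregate_rescaled_mse_limit (Λ V C : ℝ)
    (hΛ : 0 < Λ) (hV : 0 ≤ V) (hC : 0 ≤ C)
    (ε : ℕ → ℝ) (hε : ∀ n, 0 < ε n)
    (hlim : Tendsto (fun n : ℕ => (n : ℝ) ^ ((1 : ℝ) / 6) * ε n) atTop atTop)
    (k : ℕ → ℕ)
    (hk : ∀ n, k n = ⌈(n : ℝ) ^ ((3 : ℝ) / 5) * Λ ^ ((2 : ℝ) / 5) * ε n ^ (-(2 : ℝ) / 5)⌉₊)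
    (v b : ℕ → ℝ) (hv : ∀ n, 0 ≤ v n)
    (hvV : Tendsto (fun n : ℕ => ((n : ℝ) / (k n : ℝ)) * v n) atTop (nhds V))
    (hb : ∀ n, |b n| ≤ C * ((k n : ℝ) / (n : ℝ)) ^ ((3 : ℝ) / 2)) :
    Tendsto
      (fun n : ℕ =>
        (n : ℝ) * (v n / (k n : ℝ) + b n ^ 2 + 2 * Λ ^ 2 / ((k n : ℝ) ^ 2 * ε n ^ 2)))
      atTop (nhds V) := by
  have hL : 0 < Λ ^ ((2 : ℝ) / 5) := by positivity
  have hbias := tendsto_mul_sq_bias (tendsto_blocks_pow_three_div_sq hL.le hε hlim hk) hb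
  have hnoise := tendsto_mul_laplace_variance hL (2 * Λ ^ 2) hε hlim hk
  have h := (hvV.add hbias).add hnoise
  rw [add_zero, add_zero] at h
  exact h.congr fun n => by ring
end
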